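/- For every integer r ≥ 1 and every natural number m, the following identity of formal power series over ℚ holds: ∑_{n≥0} ((m-n+1)/(m+1)) · ⟨m+1 choose n⟩_r · t^n = (1−t^r)^m · (1−t)^{-(m+2)} · ( r·t^r·(1−t) + (1−t^r)·(1−2t) ), where (1−t)^{-(m+2)} denotes the inverse of (1−t)^{m+2} in the ring of formal power series, and the left-hand sum is finite since ⟨m+1 choose n⟩_r = 0 for n > (r-1)(m+1). In particular, for n ≤ m the coefficient of t^n on the right-hand side equals the number of ballot paths to (n,m) avoiding r consecutive E-steps. -/

import Mathlib

/-- A word in steps `N = true` (up, `(0,1)`) and `E = false` (right, `(1,0)`) is a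
ballot word when every prefix has at least as many `N`-steps as `E`-steps,
i.e. the corresponding lattice path from `(0,0)` stays weakly above `y = x`. -/
def IsBallot (p : List Bool) : Prop :=
  ∀ q : List Bool, q <+: p → q.count false ≤ q.count true

/-- `sCount r n m` is the number of ballot paths from `(0,0)` to `(n,m)`
(with `n` east-steps and `m` north-steps, staying weakly above `y = x`)
containing no `r` consecutive east-steps. -/
noncomputable def sCount (r n m : ℕ) : ℕ :=
  Set.ncard {p : List Bool |
    p.count false = n ∧ p.count true = m ∧ IsBallot p ∧ ¬ List.replicate r false <:+: p}

/-- The Euler coefficient `⟨x choose k⟩_r` over `ℚ`: the coefficient of `t^k` in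
the polynomial `(1 + t + t^2 + ⋯ + t^(r-1))^x`. -/
noncomputable def eulerCoeffQ (r x k : ℕ) : ℚ :=
  ((∑ i ∈ Finset.range r, (Polynomial.X : Polynomial ℚ) ^ i) ^ x).coeff k

open PowerSeries in
/-- The weighted generating function of the Euler coefficients, in terms of
`P = 1 + t + ⋯ + t^(r-1)` and its derivative. -/
theorem mk_weighted_eulerCoeffQ (r m : ℕ) :
    (PowerSeries.mk fun n : ℕ =>
        (((m : ℚ) - n + 1) / ((m : ℚ) + 1)) * eulerCoeffQ r (m + 1) n) =
      (∑ i ∈ Finset.range r, (X : PowerSeries ℚ) ^ i) ^ m *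
        ((∑ i ∈ Finset.range r, X ^ i) - X * d⁄dX ℚ (∑ i ∈ Finset.range r, X ^ i)) := by
  set P : PowerSeries ℚ := ∑ i ∈ Finset.range r, X ^ i with hP
  have hcoeff (n : ℕ) : eulerCoeffQ r (m + 1) n = coeff n (P ^ (m + 1)) := by
    rw [eulerCoeffQ, ← Polynomial.coeff_coe]
    congr 1
    rw [Polynomial.coe_pow, ← Polynomial.coeToPowerSeries.ringHom_apply, map_sum]
    simp [hP]
  have hX (Q : PowerSeries ℚ) (n : ℕ) : coeff n (X * d⁄dX ℚ Q) = n * coeff n Q := by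
    cases n with
    | zero => simp
    | succ n => rw [coeff_succ_X_mul, coeff_derivative]; push_cast; ring
  have hm : (m : ℚ) + 1 ≠ 0 := by positivity
  have hpow : C ((m : ℚ) + 1) * (P ^ m * (P - X * d⁄dX ℚ P)) =
      C ((m : ℚ) + 1) * P ^ (m + 1) - X * d⁄dX ℚ (P ^ (m + 1)) := by
    rw [Derivation.leibniz_pow]
    simp only [map_add, map_natCast, map_one, Nat.add_sub_cancel, smul_eq_mul, nsmul_eq_mul]
    push_cast
    ring
  ext n
  have := congrArg (coeff n) hpow
  rw [map_sub, hX, coeff_C_mul, coeff_C_mul] at this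
  rw [coeff_mk, hcoeff]
  field_simp
  linear_combination -this

open PowerSeries in
theorem closed_form_eq_geom_sum (r m : ℕ) (hr : 1 ≤ r) :
    (1 - X ^ r) ^ m * ((1 - X : PowerSeries ℚ) ^ (m + 2))⁻¹ *
        ((r : PowerSeries ℚ) * X ^ r * (1 - X) + (1 - X ^ r) * (1 - 2 * X)) =
      (∑ i ∈ Finset.range r, (X : PowerSeries ℚ) ^ i) ^ m *
        ((∑ i ∈ Finset.range r, X ^ i) - X * d⁄dX ℚ (∑ i ∈ Finset.range r, X ^ i)) := by
  set P : PowerSeries ℚ := ∑ i ∈ Finset.range r, X ^ i with hP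
  have hgeom : (1 - X) * P = 1 - X ^ r := mul_neg_geom_sum X r
  have hderiv : (1 - X) * (X * d⁄dX ℚ P) = X * P - (r : PowerSeries ℚ) * X ^ r := by
    have := congrArg (fun Q => X * d⁄dX ℚ Q) hgeom
    obtain ⟨s, rfl⟩ := Nat.exists_eq_add_of_le' hr
    simp only [Derivation.leibniz, Derivation.leibniz_pow, map_sub, Derivation.map_one_eq_zero,
      derivative_X, smul_eq_mul, nsmul_eq_mul, Nat.add_sub_cancel] at this
    linear_combination this
  have hunit : constantCoeff ((1 - X : PowerSeries ℚ) ^ (m + 2)) ≠ 0 := by simp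
  rw [mul_right_comm, eq_comm, PowerSeries.eq_mul_inv_iff_mul_eq hunit, ← hgeom, mul_pow]
  linear_combination (-P ^ m * (1 - X) ^ (m + 1)) * hderiv

theorem isBallot_concat (p : List Bool) (a : Bool) :
    IsBallot (p ++ [a]) ↔
      IsBallot p ∧ (p ++ [a]).count false ≤ (p ++ [a]).count true := by
  simp only [IsBallot, List.prefix_concat_iff]
  grind

theorem IsBallot.count_le {p : List Bool} (h : IsBallot p) : p.count false ≤ p.count true :=
  h p List.prefix_rfl

theorem isBallot_append_true_replicate (p : List Bool) (j : ℕ)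
    (hle : p.count false + j ≤ p.count true + 1) (hp : p.count false ≤ p.count true) :
    IsBallot (p ++ true :: List.replicate j false) ↔ IsBallot p := by
  induction j with
  | zero => simp [isBallot_concat]; omega
  | succ j ih =>
    rw [List.replicate_succ', ← List.cons_append, ← List.append_assoc, isBallot_concat,
      ih (by omega)]
    simp [List.count_replicate]
    omega

theorem IsBallot.of_append {p q : List Bool} (h : IsBallot (p ++ q)) : IsBallot p :=
  fun s hs => h s (hs.trans (List.prefix_append p q))

theorem replicate_prefix_replicate_append_true (r j : ℕ) (l : List Bool) :
    List.replicate r false <+: List.replicate j false ++ true :: l ↔ r ≤ j := by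
  induction r generalizing j with
  | zero => simp
  | succ r ih =>
    cases j with
    | zero => simp [List.replicate_succ]
    | succ j => simp [List.replicate_succ, List.cons_prefix_cons, ih]

theorem replicate_suffix_append_true_replicate (r j : ℕ) (p : List Bool) :
    List.replicate r false <:+ p ++ true :: List.replicate j false ↔ r ≤ j := by
  rw [← List.reverse_prefix]
  simpa using replicate_prefix_replicate_append_true r j p.reverse

theorem replicate_infix_append_true_replicate (r j : ℕ) (p : List Bool) :
    List.replicate r false <:+: p ++ true :: List.replicate j false ↔
      List.replicate r false <:+: p ∨ r ≤ j := by
  induction j with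
  | zero =>
    have := replicate_suffix_append_true_replicate r 0 p
    rw [List.replicate_zero] at *
    rw [List.infix_concat_iff, this, or_comm]
  | succ j ih =>
    have := replicate_suffix_append_true_replicate r (j + 1) p
    rw [List.replicate_succ', ← List.cons_append, ← List.append_assoc] at *
    rw [List.infix_concat_iff, this, ih]
    grind

theorem append_true_replicate_inj {p q : List Bool} {i j : ℕ}
    (h : p ++ true :: List.replicate i false = q ++ true :: List.replicate j false) :
    p = q ∧ i = j := by
  have hij : i = j := by
    apply le_antisymm
    · rw [← replicate_suffix_append_true_replicate i j q, ← h,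
        replicate_suffix_append_true_replicate]
    · rw [← replicate_suffix_append_true_replicate j i p, h,
        replicate_suffix_append_true_replicate]
  subst hij
  exact ⟨List.append_cancel_right h, rfl⟩

theorem exists_eq_append_true_replicate {l : List Bool} (h : true ∈ l) :
    ∃ p j, l = p ++ true :: List.replicate j false := by
  induction l using List.reverseRecOn with
  | nil => simp at h
  | append_singleton l a ih =>
    cases a with
    | true => exact ⟨l, 0, rfl⟩
    | false =>
      obtain ⟨p, j, rfl⟩ := ih (by simpa using h)
      exact ⟨p, j + 1, by simp [List.replicate_succ']⟩

/-- The set of lattice words counted by `sCount`. -/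
def ballotWords (r n m : ℕ) : Set (List Bool) :=
  {p | p.count false = n ∧ p.count true = m ∧ IsBallot p ∧ ¬ List.replicate r false <:+: p}

theorem ballotWords_finite (r n m : ℕ) : (ballotWords r n m).Finite := by
  refine (List.finite_length_eq Bool (n + m)).subset ?_
  rintro p ⟨rfl, rfl, -⟩
  simp [List.count_false_add_count_true]

theorem ballotWords_succ (r n m : ℕ) (hn : n ≤ m + 1) :
    ballotWords r n (m + 1) = ⋃ j ∈ (Finset.range r).filter (· ≤ n),
      (fun p => p ++ true :: List.replicate j false) '' ballotWords r (n - j) m := by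
  ext l
  simp only [ballotWords, Set.mem_iUnion, Set.mem_image, Set.mem_ofPred_eq, Finset.mem_filter,
    Finset.mem_range, exists_prop]
  constructor
  · rintro ⟨hf, ht, hb, hi⟩
    obtain ⟨p, j, rfl⟩ := exists_eq_append_true_replicate
      (l := l) (List.count_pos_iff.mp (by omega))
    rw [replicate_infix_append_true_replicate r j p] at hi
    simp [List.count_replicate] at hf ht
    exact ⟨j, by grind, p, ⟨by omega, ht, hb.of_append, by tauto⟩, rfl⟩
  · rintro ⟨j, ⟨hjr, hjn⟩, p, ⟨hf, ht, hb, hi⟩, rfl⟩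
    have hle := hb.count_le
    refine ⟨by simp; omega, by simp [List.count_replicate]; omega,
      (isBallot_append_true_replicate p j (by omega) hle).mpr hb, ?_⟩
    rw [replicate_infix_append_true_replicate r j p]
    grind

theorem sCount_succ (r n m : ℕ) (hn : n ≤ m + 1) :
    sCount r n (m + 1) = ∑ j ∈ Finset.range r, if j ≤ n then sCount r (n - j) m else 0 := by
  classical
  rw [← Finset.sum_filter]
  change (ballotWords r n (m + 1)).ncard = ∑ j ∈ _, (ballotWords r (n - j) m).ncard
  have hU : ballotWords r n (m + 1) = ↑(((Finset.range r).filter (· ≤ n)).biUnion fun j =>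
      (ballotWords_finite r (n - j) m).toFinset.image
        (fun p => p ++ true :: List.replicate j false)) := by
    rw [ballotWords_succ r n m hn]
    simp
  rw [hU, Set.ncard_coe_finset, Finset.card_biUnion]
  · refine Finset.sum_congr rfl fun j _ => ?_
    rw [Finset.card_image_of_injective _ fun p q h => (append_true_replicate_inj h).1,
      Set.ncard_eq_toFinset_card _ (ballotWords_finite r (n - j) m)]
  · intro i _ j _ hij
    rw [Function.onFun, Finset.disjoint_left]
    simp only [Finset.mem_image, not_exists, not_and]
    rintro _ ⟨p, -, rfl⟩ q - h
    exact hij (append_true_replicate_inj h).2.symm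

theorem sCount_eq_zero_of_lt (r : ℕ) {n m : ℕ} (h : m < n) : sCount r n m = 0 := by
  have : ballotWords r n m = ∅ := by
    refine Set.eq_empty_of_forall_notMem ?_
    rintro p ⟨hf, ht, hb, -⟩
    have := hb.count_le
    omega
  change (ballotWords r n m).ncard = 0
  rw [this, Set.ncard_empty]

theorem sCount_zero_zero (r : ℕ) (hr : 1 ≤ r) : sCount r 0 0 = 1 := by
  have : ballotWords r 0 0 = {[]} := by
    ext p
    simp only [ballotWords, Set.mem_ofPred_eq, Set.mem_singleton_iff]
    constructor
    · rintro ⟨hf, ht, -⟩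
      have := List.count_false_add_count_true p
      exact List.length_eq_zero_iff.mp (by omega)
    · rintro rfl
      simp [IsBallot]
      omega
  change (ballotWords r 0 0).ncard = 1
  rw [this, Set.ncard_singleton]

open PowerSeries in
theorem sCount_eq_coeff (r : ℕ) (hr : 1 ≤ r) (m n : ℕ) (hn : n ≤ m) :
    (sCount r n m : ℚ) = coeff n ((∑ i ∈ Finset.range r, (X : PowerSeries ℚ) ^ i) ^ m *
        ((∑ i ∈ Finset.range r, X ^ i) - X * d⁄dX ℚ (∑ i ∈ Finset.range r, X ^ i))) := by
  induction m generalizing n with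
  | zero =>
    obtain rfl : n = 0 := by omega
    obtain ⟨s, rfl⟩ := Nat.exists_eq_add_of_le' hr
    simp [sCount_zero_zero, Finset.sum_range_succ']
  | succ m ih =>
    rw [sCount_succ r n m hn, pow_succ', mul_assoc, Finset.sum_mul, map_sum, Nat.cast_sum]
    refine Finset.sum_congr rfl fun j _ => ?_
    rw [coeff_X_pow_mul']
    split_ifs with hj
    · by_cases hm : n - j ≤ m
      · exact ih _ hm
      · have hnj : n - j = m + 1 := by omega
        rw [sCount_eq_zero_of_lt r (by omega), hnj, ← mk_weighted_eulerCoeffQ, coeff_mk]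
        simp
    · simp

theorem genFunc_sCount (r : ℕ) (hr : 1 ≤ r) (m : ℕ) :
    (PowerSeries.mk fun n : ℕ =>
        (((m : ℚ) - n + 1) / ((m : ℚ) + 1)) * eulerCoeffQ r (m + 1) n) =
      (1 - PowerSeries.X ^ r) ^ m * ((1 - PowerSeries.X : PowerSeries ℚ) ^ (m + 2))⁻¹ *
        ((r : PowerSeries ℚ) * PowerSeries.X ^ r * (1 - PowerSeries.X) +
          (1 - PowerSeries.X ^ r) * (1 - 2 * PowerSeries.X)) ∧
    ∀ n : ℕ, n ≤ m →
      PowerSeries.coeff (R := ℚ) n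
          ((1 - PowerSeries.X ^ r) ^ m * ((1 - PowerSeries.X : PowerSeries ℚ) ^ (m + 2))⁻¹ *
            ((r : PowerSeries ℚ) * PowerSeries.X ^ r * (1 - PowerSeries.X) +
              (1 - PowerSeries.X ^ r) * (1 - 2 * PowerSeries.X))) =
        sCount r n m := by
  rw [closed_form_eq_geom_sum r m hr]
  exact ⟨mk_weighted_eulerCoeffQ r m, fun n hn => (sCount_eq_coeff r hr m n hn).symm⟩
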